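/- arXiv:2511.19012 — 2 statements merged into one kernel-verified Lean document; each statement's English description precedes it below -/
import Mathlib

section
/- Let G be a nilpotent multiplicative Lie algebra of class n and H a subalgebra of G such that G = ^M[G,G]·H (the set of products of elements of ^M[G,G] with elements of H). Then H = G. -/
/-- A multiplicative Lie algebra: a group `G` with a binary operation `⋆`
satisfying the five defining identities (where `ᵍh = g*h*g⁻¹`). -/
class MulLieAlgebra (G : Type*) extends Group G where
  star : G → G → G
  star_self : ∀ g : G, star g g = 1
  star_mul_right : ∀ g h k : G, star g (h * k) = star g h * (h * star g k * h⁻¹)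
  star_mul_left : ∀ g h k : G, star (g * h) k = (g * star h k * g⁻¹) * star g k
  star_jacobi : ∀ g h k : G,
    star (star g h) (h * k * h⁻¹) * star (star h k) (k * g * k⁻¹) *
      star (star k g) (g * h * g⁻¹) = 1
  conj_star : ∀ g h k : G, k * star g h * k⁻¹ = star (k * g * k⁻¹) (k * h * k⁻¹)

namespace MulLieAlgebra

local infixl:72 " ⋆ " => MulLieAlgebra.star

variable {G : Type*} [MulLieAlgebra G]

/-- A subalgebra: a subgroup closed under the Lie product. -/
def IsSubalgebra (H : Subgroup G) : Prop :=
  ∀ x ∈ H, ∀ y ∈ H, (x ⋆ y) ∈ H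

/-- An ideal: a normal subgroup `H` with `g ⋆ h ∈ H` for all `g ∈ G`, `h ∈ H`. -/
def IsIdeal (H : Subgroup G) : Prop :=
  H.Normal ∧ ∀ g : G, ∀ h ∈ H, (g ⋆ h) ∈ H

/-- The subalgebra generated by a subset `X`. -/
def subalgebraClosure (X : Set G) : Subgroup G :=
  sInf {H : Subgroup G | IsSubalgebra H ∧ X ⊆ (H : Set G)}

/-- A maximal (proper) subalgebra. -/
def IsMaximalSubalgebra (M : Subgroup G) : Prop :=
  IsSubalgebra M ∧ M ≠ ⊤ ∧ ∀ N : Subgroup G, IsSubalgebra N → M < N → N = ⊤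

/-- The M-Frattini subalgebra `Φ̃(G)`: the intersection of all maximal subalgebras
(`sInf ∅ = ⊤`, so it equals `G` when there is no maximal subalgebra). -/
def frattini (G : Type*) [MulLieAlgebra G] : Subgroup G :=
  sInf {M : Subgroup G | IsMaximalSubalgebra M}

end MulLieAlgebra

namespace MulLieAlgebra

local infixl:72 " ⋆ " => MulLieAlgebra.star

/-- The upper central series of a multiplicative Lie algebra:
`Z₀ = {1}`, `Z_{k+1} = {g : [g,x] ∈ Z_k and g ⋆ x ∈ Z_k for all x}`. -/
def upperCentral (G : Type*) [MulLieAlgebra G] : ℕ → Set G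
  | 0 => {(1 : G)}
  | n + 1 => {g : G | ∀ x : G,
      g * x * g⁻¹ * x⁻¹ ∈ upperCentral G n ∧ (g ⋆ x) ∈ upperCentral G n}

end MulLieAlgebra

namespace MulLieAlgebra

local infixl:72 " ⋆ " => MulLieAlgebra.star

/-- The multiplicative commutator `^M[G,G]`: the subgroup generated by all
group commutators and all Lie products. -/
def mulCommutator (G : Type*) [MulLieAlgebra G] : Subgroup G :=
  Subgroup.closure
    ({x : G | ∃ a b : G, x = a * b * a⁻¹ * b⁻¹} ∪ {x : G | ∃ a b : G, x = a ⋆ b})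

end MulLieAlgebra

namespace MulLieAlgebra

local infixl:72 " ⋆ " => MulLieAlgebra.star

section helpers
variable {G : Type*} [MulLieAlgebra G]

theorem aux_one_star (x : G) : (1 : G) ⋆ x = 1 := by
  have h := star_mul_left (1 : G) 1 x
  simpa using h

theorem aux_antisymm (g h : G) : (h ⋆ g) * (g ⋆ h) = 1 := by
  have e := star_self (g * h)
  rw [star_mul_left, star_mul_right h, star_mul_right g, star_self, star_self] at e
  have e2 : g * ((h ⋆ g) * (g ⋆ h)) * g⁻¹ = 1 := by
    rw [← e]; group
  simpa using e2

theorem aux_star_swap (g h : G) : h ⋆ g = (g ⋆ h)⁻¹ :=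
  eq_inv_of_mul_eq_one_left (aux_antisymm g h)

theorem aux_inv_star (g x : G) : g⁻¹ ⋆ x = g⁻¹ * (g ⋆ x)⁻¹ * g := by
  have h := star_mul_left g g⁻¹ x
  rw [mul_inv_cancel, aux_one_star] at h
  have h2 := eq_inv_of_mul_eq_one_left h.symm
  rw [← h2]; group

/-- The terms of the upper central series are normal subgroups. -/
theorem aux_upperCentral (k : ℕ) :
    ∃ N : Subgroup G, N.Normal ∧ (N : Set G) = upperCentral G k := by
  induction k with
  | zero => exact ⟨⊥, inferInstance, by simp [upperCentral]⟩
  | succ k ih =>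
    obtain ⟨N, hN, hNe⟩ := ih
    let M : Subgroup G :=
      { carrier := {g : G | ∀ x : G, g * x * g⁻¹ * x⁻¹ ∈ N ∧ (g ⋆ x) ∈ N}
        one_mem' := fun x => by simp [aux_one_star, N.one_mem]
        mul_mem' := by
          intro a b ha hb x
          constructor
          · have := N.mul_mem (hN.conj_mem _ (hb x).1 a) (ha x).1
            convert this using 1
            group
          · rw [star_mul_left]
            exact N.mul_mem (hN.conj_mem _ (hb x).2 a) (ha x).2
        inv_mem' := by
          intro a ha x
          constructor
          · have := hN.conj_mem _ (N.inv_mem (ha x).1) a⁻¹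
            convert this using 1
            group
          · rw [aux_inv_star]
            have := hN.conj_mem _ (N.inv_mem (ha x).2) a⁻¹
            simpa using this }
    refine ⟨M, ⟨?_⟩, ?_⟩
    · intro a ha g x
      constructor
      · have := hN.conj_mem _ (ha (g⁻¹ * x * g)).1 g
        convert this using 1
        group
      · have := hN.conj_mem _ (ha (g⁻¹ * x * g)).2 g
        rw [conj_star] at this
        convert this using 2
        group
    · ext g
      simp only [upperCentral, ← hNe]
      rfl

theorem aux_step (k : ℕ) (H : Subgroup G) (hH : IsSubalgebra H)
    (hgen : ∀ g : G, ∃ c ∈ mulCommutator G, ∃ h ∈ H, g = c * h)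
    (hk : ∀ g : G, ∃ z ∈ upperCentral G (k + 1), ∃ h ∈ H, g = z * h) :
    ∀ g : G, ∃ z ∈ upperCentral G k, ∃ h ∈ H, g = z * h := by
  obtain ⟨N, hN, hNe⟩ := aux_upperCentral (G := G) k
  have hZ : ∀ z ∈ upperCentral G (k + 1), ∀ x : G,
      z * x * z⁻¹ * x⁻¹ ∈ N ⊔ H ∧ (z ⋆ x) ∈ N ⊔ H := by
    intro z hz x
    have h := hz x
    rw [← hNe] at h
    exact ⟨Subgroup.mem_sup_left h.1, Subgroup.mem_sup_left h.2⟩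
  have hconj : ∀ z ∈ upperCentral G (k + 1), ∀ t ∈ N ⊔ H, z * t * z⁻¹ ∈ N ⊔ H := by
    intro z hz t ht
    have := (N ⊔ H).mul_mem (hZ z hz t).1 ht
    simpa using this
  have hle : mulCommutator G ≤ N ⊔ H := by
    unfold mulCommutator
    rw [Subgroup.closure_le]
    rintro x (⟨a, b, rfl⟩ | ⟨a, b, rfl⟩)
    · obtain ⟨z, hz, h, hh, rfl⟩ := hk a
      obtain ⟨w, hw, l, hl, rfl⟩ := hk b
      have h1 : h * l * h⁻¹ * l⁻¹ ∈ N ⊔ H := Subgroup.mem_sup_right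
        (H.mul_mem (H.mul_mem (H.mul_mem hh hl) (H.inv_mem hh)) (H.inv_mem hl))
      have h2 := (N ⊔ H).mul_mem ((N ⊔ H).inv_mem (hZ w hw h).1) (hconj w hw _ h1)
      have h3 := (N ⊔ H).mul_mem (hconj z hz _ h2) (hZ z hz (w * l)).1
      rw [SetLike.mem_coe]
      convert h3 using 1
      group
    · obtain ⟨z, hz, h, hh, rfl⟩ := hk a
      obtain ⟨w, hw, l, hl, rfl⟩ := hk b
      have h1 : (h ⋆ l) ∈ N ⊔ H := Subgroup.mem_sup_right (hH h hh l hl)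
      have h2 := (N ⊔ H).mul_mem ((N ⊔ H).inv_mem (hZ w hw h).2) (hconj w hw _ h1)
      rw [← aux_star_swap, ← star_mul_right] at h2
      have h3 := (N ⊔ H).mul_mem (hconj z hz _ h2) (hZ z hz (w * l)).2
      rw [← star_mul_left] at h3
      exact h3
  intro g
  obtain ⟨c, hc, h, hh, rfl⟩ := hgen g
  have hm : c * h ∈ N ⊔ H := (N ⊔ H).mul_mem (hle hc) (Subgroup.mem_sup_right hh)
  rw [← SetLike.mem_coe, Subgroup.normal_mul] at hm
  obtain ⟨z, hz, y, hy, e⟩ := Set.mem_mul.1 hm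
  exact ⟨z, hNe ▸ hz, y, hy, e.symm⟩

end helpers

/-- if `G` is nilpotent of class `n` and `H` is a subalgebra with
`G = ^M[G,G]·H`, then `H = G`. -/
theorem eq_top_of_mulCommutator_mul_eq {G : Type*} [MulLieAlgebra G] (n : ℕ)
    (hnil : upperCentral G n = Set.univ)
    (H : Subgroup G) (hH : IsSubalgebra H)
    (hgen : ∀ g : G, ∃ c ∈ mulCommutator G, ∃ h ∈ H, g = c * h) :
    H = ⊤ := by
  have key : ∀ m : ℕ, (∀ g : G, ∃ z ∈ upperCentral G m, ∃ h ∈ H, g = z * h) → H = ⊤ := by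
    intro m
    induction m with
    | zero =>
      intro h0
      rw [Subgroup.eq_top_iff']
      intro g
      obtain ⟨z, hz, h, hh, rfl⟩ := h0 g
      have : z = 1 := hz
      simpa [this] using hh
    | succ m ih => exact fun h => ih (aux_step m H hH hgen h)
  exact key n fun g => ⟨g, hnil ▸ Set.mem_univ g, 1, H.one_mem, by simp⟩

end MulLieAlgebra
end

section
/- Let G be a finite multiplicative Lie algebra, K an ideal of G, and H a subalgebra of G with K ⊆ H. If K ⊆ Φ̃(H), then K ⊆ Φ̃(G). -/
namespace MulLieAlgebra

local infixl:72 " ⋆ " => MulLieAlgebra.star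

variable {G : Type*} [MulLieAlgebra G]

end MulLieAlgebra

namespace MulLieAlgebra

variable {G : Type*} [MulLieAlgebra G]

/-- A maximal proper subalgebra of the subalgebra `H` (all inside `G`). -/
def IsMaximalSubalgebraIn (H M : Subgroup G) : Prop :=
  IsSubalgebra M ∧ M < H ∧ ∀ N : Subgroup G, IsSubalgebra N → N ≤ H → M < N → N = H

/-- The M-Frattini subalgebra `Φ̃(H)` of a subalgebra `H` of `G`: the
intersection of all maximal proper subalgebras of `H` (and `H` itself when
`H` has no maximal subalgebra, since then `sInf ∅ = ⊤`). -/
def frattiniIn (H : Subgroup G) : Subgroup G :=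
  H ⊓ sInf {M : Subgroup G | IsMaximalSubalgebraIn H M}

end MulLieAlgebra

namespace MulLieAlgebra

theorem star_mul_swap {G : Type*} [MulLieAlgebra G] (g h : G) : star h g * star g h = 1 := by
  have e := star_self (g * h)
  rw [star_mul_right, star_mul_left g h g, star_mul_left g h h, star_self, star_self] at e
  have e2 : g * (star h g * star g h) * g⁻¹ = 1 := by
    rw [← e]; group
  have e3 := conj_eq_one_iff.mp e2
  exact e3

theorem isSubalgebra_sup {G : Type*} [MulLieAlgebra G] (M K : Subgroup G)
    (hM : IsSubalgebra M) (hK : IsIdeal K) : IsSubalgebra (M ⊔ K) := by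
  obtain ⟨hn, hi⟩ := hK
  have hi' : ∀ k ∈ K, ∀ g : G, star k g ∈ K := by
    intro k hk g
    rw [eq_inv_of_mul_eq_one_left (star_mul_swap g k)]
    exact K.inv_mem (hi g k hk)
  intro x hx y hy
  obtain ⟨m, hm, k, hk, rfl⟩ := Subgroup.mem_sup_of_normal_right.mp hx
  obtain ⟨m', hm', k', hk', rfl⟩ := Subgroup.mem_sup_of_normal_right.mp hy
  rw [star_mul_right, star_mul_left m k m']
  have hKs : K ≤ M ⊔ K := le_sup_right
  have hMs : M ≤ M ⊔ K := le_sup_left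
  exact mul_mem (mul_mem (hKs (hn.conj_mem _ (hi' k hk m') m)) (hMs (hM m hm m' hm')))
    (hKs (hn.conj_mem _ (hi _ k' hk') m'))

/-- if `G` is a finite multiplicative Lie algebra, `K` an ideal,
`H` a subalgebra with `K ⊆ H` and `K ⊆ Φ̃(H)`, then `K ⊆ Φ̃(G)`. -/
theorem le_frattini_of_le_frattiniIn {G : Type*} [MulLieAlgebra G] [Finite G]
    (K H : Subgroup G) (hK : IsIdeal K) (hH : IsSubalgebra H) (hKH : K ≤ H)
    (h : K ≤ frattiniIn H) :
    K ≤ frattini G := by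
  refine le_sInf ?_
  rintro M ⟨hM, -, hmax⟩
  by_contra hKM
  have htop : M ⊔ K = ⊤ := hmax _ (isSubalgebra_sup M K hM hK) (left_lt_sup.mpr hKM)
  have hlt : H ⊓ M < H := inf_lt_left.mpr fun hle => hKM (hKH.trans hle)
  have hsub : IsSubalgebra (H ⊓ M) := fun x hx y hy =>
    ⟨hH x hx.1 y hy.1, hM x hx.2 y hy.2⟩
  obtain ⟨N, hle, hN⟩ := (Set.toFinite {N : Subgroup G | IsSubalgebra N ∧ N < H}).exists_le_maximal
    (show H ⊓ M ∈ {N : Subgroup G | IsSubalgebra N ∧ N < H} from ⟨hsub, hlt⟩)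
  have hNmax : IsMaximalSubalgebraIn H N := by
    refine ⟨hN.prop.1, hN.prop.2, fun L hL hLH hNL => ?_⟩
    by_contra hne
    exact hN.not_gt (show L ∈ {N : Subgroup G | IsSubalgebra N ∧ N < H} from
      ⟨hL, lt_of_le_of_ne hLH hne⟩) hNL
  have hKN : K ≤ N := (h.trans inf_le_right).trans (sInf_le hNmax)
  refine hN.prop.2.not_ge fun x hx => ?_
  have hn := hK.1
  obtain ⟨m, hm, k, hk, rfl⟩ := Subgroup.mem_sup_of_normal_right.mp
    (show x ∈ M ⊔ K by rw [htop]; trivial)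
  exact N.mul_mem (hle ⟨(H.mul_mem_cancel_right (hKH hk)).mp hx, hm⟩) (hKN hk)

end MulLieAlgebra
end
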